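/- arXiv:1410.1344 — 3 statements merged into one kernel-verified Lean document; each statement's English description precedes it below -/
import Mathlib

section
/- If E is a linearly ordered semitopological semilattice that is H-closed in the class of semitopological semilattices and e ∈ E, then the up-set ↑e = {x ∈ E : e ≤ x} and the down-set ↓e = {x ∈ E : x ≤ e}, with the subspace topology and induced operation, are absolutely H-closed topological semilattices in the class of semitopological semilattices. -/
open Topology

universe u v

/-- A semilattice: a commutative semigroup all of whose elements are idempotent. -/
def IsSemilatticeMul (E : Type u) [Mul E] : Prop :=
  (∀ x y z : E, x * y * z = x * (y * z)) ∧ (∀ x y : E, x * y = y * x) ∧ ∀ x : E, x * x = x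

/-- A (Hausdorff) semitopological semilattice: a semilattice with a Hausdorff topology
in which all translations are continuous. -/
def IsSemitopologicalSemilattice (E : Type u) [Mul E] [TopologicalSpace E] : Prop :=
  IsSemilatticeMul E ∧ T2Space E ∧ ∀ a : E, Continuous fun x : E => a * x

/-- A (Hausdorff) topological semilattice: a semilattice with a Hausdorff topology
in which the operation is jointly continuous. -/
def IsTopologicalSemilattice (E : Type u) [Mul E] [TopologicalSpace E] : Prop :=
  IsSemilatticeMul E ∧ T2Space E ∧ Continuous fun p : E × E => p.1 * p.2

/-- `E` is `H`-closed in the class of semitopological semilattices: the image of `E`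
under any homomorphic topological embedding into a semitopological semilattice is closed. -/
def HClosedInSemitopSemilattices (E : Type u) [Mul E] [TopologicalSpace E] : Prop :=
  ∀ (T : Type u) [Mul T] [TopologicalSpace T], IsSemitopologicalSemilattice T →
    ∀ f : E → T, (∀ x y : E, f (x * y) = f x * f y) → IsEmbedding f →
      IsClosed (Set.range f)

open Filter

/-- The topology on `Option E` in which `E` is open and carries its own topology, and the
traces on `E` of the neighbourhoods of the added point `none` belong to the filter `F`. -/
abbrev adjoinPointTopology {E : Type u} [TopologicalSpace E] (F : Filter E) :
    TopologicalSpace (Option E) where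
  IsOpen U := IsOpen (some ⁻¹' U) ∧ (none ∈ U → some ⁻¹' U ∈ F)
  isOpen_univ := ⟨isOpen_univ, fun _ => univ_mem⟩
  isOpen_inter _ _ hU hV := ⟨hU.1.inter hV.1, fun h => inter_mem (hU.2 h.1) (hV.2 h.2)⟩
  isOpen_sUnion s hs := by
    refine ⟨?_, ?_⟩
    · rw [Set.preimage_sUnion]
      exact isOpen_biUnion fun U hU => (hs U hU).1
    · rintro ⟨U, hU, hn⟩
      exact mem_of_superset ((hs U hU).2 hn) (Set.preimage_mono (Set.subset_sUnion_of_mem hU))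

open Classical in
/-- The multiplication on `Option E` which extends that of `E` and for which the added point
`none` lies above the points of `A` and below the other points of `E`. -/
noncomputable abbrev adjoinPointMul {E : Type u} [Mul E] (A : Set E) : Mul (Option E) where
  mul
    | some x, some y => some (x * y)
    | some x, none => if x ∈ A then some x else none
    | none, some y => if y ∈ A then some y else none
    | none, none => none

theorem not_hClosed_of_cut {E : Type u} [Mul E] [TopologicalSpace E]
    (hE : IsSemitopologicalSemilattice E) (A : Set E) (F : Filter E) [F.NeBot]
    (hA : IsClopen A) (hmul : ∀ x ∈ A, ∀ y, x * y ∈ A)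
    (hmul' : ∀ x ∉ A, ∀ y ∉ A, x * y ∉ A) (hle : ∀ x ∈ A, ∀ y ∉ A, x * y = x)
    (hlow : ∀ x ∈ A, ∀ᶠ y in F, x * y = x) (hup : ∀ x ∉ A, ∀ᶠ y in F, x * y = y)
    (hsep : ∀ x, ∃ U V : Set E, IsOpen U ∧ IsOpen V ∧ x ∈ U ∧ V ∈ F ∧ Disjoint U V) :
    ¬ HClosedInSemitopSemilattices E := by
  classical
  obtain ⟨⟨hassoc, hcomm, hidem⟩, hT2, hcont⟩ := hE
  intro hH
  let _ := adjoinPointTopology F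
  let _ := adjoinPointMul A
  have hss : ∀ x y : E, (some x * some y : Option E) = some (x * y) := fun _ _ => rfl
  have hsn : ∀ x : E, (some x * none : Option E) = if x ∈ A then some x else none :=
    fun _ => rfl
  have hns : ∀ x : E, (none * some x : Option E) = if x ∈ A then some x else none :=
    fun _ => rfl
  have hnn : (none * none : Option E) = none := rfl
  have hle' : ∀ x ∈ A, ∀ y ∉ A, y * x = x := fun x hx y hy => by rw [hcomm, hle x hx y hy]
  have hmul'' : ∀ x ∈ A, ∀ y, y * x ∈ A := fun x hx y => by
    rw [hcomm]; exact hmul x hx y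
  have hopen : ∀ U : Set (Option E),
      IsOpen U ↔ IsOpen (some ⁻¹' U) ∧ (none ∈ U → some ⁻¹' U ∈ F) := fun _ => Iff.rfl
  have hsomeOpen : ∀ U : Set E, IsOpen U → IsOpen (some '' U : Set (Option E)) := by
    intro U hU
    rw [hopen, Set.preimage_image_eq _ (Option.some_injective E)]
    simp [hU]
  have hsep' : ∀ x : E, ∃ U V : Set (Option E), IsOpen U ∧ IsOpen V ∧ some x ∈ U ∧
      none ∈ V ∧ Disjoint U V := by
    intro x
    obtain ⟨U, V, hU, hV, hxU, hVF, hd⟩ := hsep x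
    refine ⟨some '' U, insert none (some '' V), hsomeOpen U hU, ?_,
      Set.mem_image_of_mem _ hxU, Set.mem_insert _ _, ?_⟩
    · have : (some ⁻¹' insert none (some '' V) : Set E) = V := by ext; simp
      rw [hopen, this]
      exact ⟨hV, fun _ => hVF⟩
    · rw [Set.disjoint_left] at hd ⊢
      rintro _ ⟨y, hy, rfl⟩ h
      exact hd hy (by simpa using h)
  have hsemi : IsSemitopologicalSemilattice (Option E) := by
    refine ⟨⟨?_, ?_, ?_⟩, ⟨?_⟩, ?_⟩
    · rintro (_ | x) (_ | y) (_ | z)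
      · rfl
      · by_cases hz : z ∈ A <;> simp [hnn, hns, hz]
      · by_cases hy : y ∈ A <;> simp [hnn, hns, hsn, hy]
      · by_cases hy : y ∈ A <;> by_cases hz : z ∈ A <;>
          simp [hns, hss, hy, hz, hmul, hmul', hle']
      · by_cases hx : x ∈ A <;> simp [hnn, hsn, hx]
      · by_cases hx : x ∈ A <;> by_cases hz : z ∈ A <;>
          simp [hns, hsn, hss, hx, hz, hle, hle']
      · by_cases hx : x ∈ A <;> by_cases hy : y ∈ A <;>
          simp [hsn, hss, hx, hy, hmul, hmul', hmul'', hle]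
      · simp [hss, hassoc]
    · rintro (_ | x) (_ | y)
      · rfl
      · rw [hsn, hns]
      · rw [hsn, hns]
      · rw [hss, hss, hcomm]
    · rintro (_ | x)
      · rfl
      · rw [hss, hidem]
    · rintro (_ | x) (_ | y) hxy
      · exact absurd rfl hxy
      · obtain ⟨U, V, hU, hV, hxU, hnV, hd⟩ := hsep' y
        exact ⟨V, U, hV, hU, hnV, hxU, hd.symm⟩
      · exact hsep' x
      · obtain ⟨U, V, hU, hV, hxU, hyV, hd⟩ := t2_separation (show x ≠ y by simpa using hxy)
        exact ⟨_, _, hsomeOpen U hU, hsomeOpen V hV, Set.mem_image_of_mem _ hxU,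
          Set.mem_image_of_mem _ hyV,
          (Set.disjoint_image_iff (Option.some_injective E)).2 hd⟩
    · rintro (_ | x)
      · refine continuous_def.2 fun U hU => (hopen _).2 ⟨?_, fun hn => ?_⟩
        · have : (some ⁻¹' ((fun z : Option E => none * z) ⁻¹' U) : Set E) =
              (some ⁻¹' U ∩ A) ∪ {y | y ∉ A ∧ none ∈ U} := by
            ext y
            by_cases hy : y ∈ A <;> simp [hns, hy]
          rw [this]
          refine ((hU.1).inter hA.isOpen).union ?_
          exact hA.compl.isOpen.inter isOpen_const
        · have hn' : none ∈ U := hn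
          filter_upwards [hU.2 hn'] with y hy
          have hy' : some y ∈ U := hy
          by_cases hyA : y ∈ A <;> simp [hns, hyA, hn', hy']
      · refine continuous_def.2 fun U hU => (hopen _).2 ⟨hU.1.preimage (hcont x), fun hn => ?_⟩
        by_cases hx : x ∈ A
        · have hn' : some x ∈ U := by simpa [hsn, hx] using hn
          filter_upwards [hlow x hx] with y hy
          simpa [hss, hy] using hn'
        · have hn' : none ∈ U := by simpa [hsn, hx] using hn
          filter_upwards [hup x hx, hU.2 hn'] with y hy hyU
          simpa [hss, hy] using hyU
  have hemb : IsEmbedding (some : E → Option E) :=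
    (IsOpenEmbedding.of_continuous_injective_isOpenMap
      (continuous_def.2 fun U hU => ((hopen U).1 hU).1) (Option.some_injective E) hsomeOpen).isEmbedding
  have hcl := (hH (Option E) hsemi some (fun _ _ => rfl) hemb).isOpen_compl
  have hmem := ((hopen _).1 hcl).2 (by simp)
  have hempty : (some ⁻¹' (Set.range (some : E → Option E))ᶜ : Set E) = ∅ := by ext; simp
  rw [hempty] at hmem
  exact empty_notMem F hmem

theorem isClosed_range_of_hClosed {E : Type u} [Mul E] [TopologicalSpace E]
    (hE : IsSemitopologicalSemilattice E) (hlin : ∀ x y : E, x * y = x ∨ x * y = y)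
    (hH : HClosedInSemitopSemilattices E) {T : Type v} [Mul T] [TopologicalSpace T]
    (hT : IsSemitopologicalSemilattice T) (h : E → T) (hc : Continuous h)
    (hh : ∀ x y, h (x * y) = h x * h y) : IsClosed (Set.range h) := by
  obtain ⟨⟨hassoc, hcomm, hidem⟩, hT2, hcont⟩ := hT
  refine isClosed_of_closure_subset fun t ht => ?_
  by_contra htr
  have hne : ∀ x, h x ≠ t := fun x hx => htr ⟨x, hx⟩
  have hcomp : ∀ x, h x * t = h x ∨ h x * t = t := by
    intro x
    have hcl : IsClosed {s | h x * s = h x ∨ h x * s = s} :=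
      (isClosed_eq (hcont _) continuous_const).union (isClosed_eq (hcont _) continuous_id)
    refine closure_minimal ?_ hcl ht
    rintro _ ⟨y, rfl⟩
    rcases hlin x y with hxy | hxy
    · exact Or.inl (by rw [← hh, hxy])
    · exact Or.inr (by rw [← hh, hxy])
  have hnot : ∀ x, h x * t ≠ h x ↔ h x * t = t := fun x =>
    ⟨(hcomp x).resolve_left, fun h1 h2 => hne x (h2.symm.trans h1)⟩
  have hct : Continuous fun x => h x * t := by
    simp_rw [fun x => hcomm (h x) t]
    exact (hcont t).comp hc
  have hF : (comap h (𝓝 t)).NeBot := comap_neBot_iff_frequently.2 (mem_closure_iff_frequently.1 ht)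
  have hlow : ∀ x, h x * t = h x → ∀ᶠ y in comap h (𝓝 t), x * y = x := by
    intro x hx
    have hev : ∀ᶠ s in 𝓝 t, h x * s ≠ s :=
      (isOpen_ne_fun (hcont _) continuous_id).mem_nhds (by simpa [hx] using hne x)
    filter_upwards [tendsto_comap.eventually hev] with y hy
    exact (hlin x y).resolve_right fun hxy => hy (by rw [← hh, hxy])
  have hup : ∀ x, h x * t = t → ∀ᶠ y in comap h (𝓝 t), x * y = y := by
    intro x hx
    have hev : ∀ᶠ s in 𝓝 t, h x * s ≠ h x :=
      (isOpen_ne_fun (hcont _) continuous_const).mem_nhds (by simpa [hx] using (hne x).symm)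
    filter_upwards [tendsto_comap.eventually hev] with y hy
    exact (hlin x y).resolve_left fun hxy => hy (by rw [← hh, hxy])
  refine not_hClosed_of_cut hE {x | h x * t = h x} (comap h (𝓝 t)) ⟨?_, ?_⟩ ?_ ?_ ?_
    hlow (fun x hx => hup x ((hnot x).1 hx)) ?_ hH
  · exact isClosed_eq hct hc
  · rw [← isClosed_compl_iff]
    have : {x | h x * t = h x}ᶜ = {x | h x * t = t} := Set.ext hnot
    rw [this]
    exact isClosed_eq hct continuous_const
  · intro x hx y
    change h (x * y) * t = h (x * y)
    rw [hh, hcomm (h x), hassoc, hx]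
  · intro x hx y hy
    refine (hnot _).2 ?_
    rw [hh, hassoc, (hnot y).1 hy, (hnot x).1 hx]
  · intro x hx y hy
    obtain ⟨z, hxz, hyz⟩ := ((hlow x hx).and (hup y ((hnot y).1 hy))).exists
    obtain ⟨⟨hassocE, hcommE, -⟩, -⟩ := hE
    calc x * y = y * (x * z) := by rw [hxz, hcommE]
      _ = x * (y * z) := by rw [← hassocE, hcommE y x, hassocE]
      _ = x := by rw [hyz, hxz]
  · intro x
    obtain ⟨U, V, hU, hV, hxU, htV, hd⟩ := t2_separation (hne x)
    exact ⟨h ⁻¹' U, h ⁻¹' V, hU.preimage hc, hV.preimage hc, hxU,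
      preimage_mem_comap (hV.mem_nhds htV), hd.preimage h⟩

theorem continuous_mul_of_linear {E : Type u} [Mul E] [TopologicalSpace E]
    (hE : IsSemitopologicalSemilattice E) (hlin : ∀ x y : E, x * y = x ∨ x * y = y) :
    Continuous fun p : E × E => p.1 * p.2 := by
  obtain ⟨⟨hassoc, hcomm, hidem⟩, hT2, hcont⟩ := hE
  have hlt : ∀ x y : E, x ≠ y → x * y = x →
      ∀ᶠ p : E × E in 𝓝 (x, y), p.1 * p.2 = p.1 := by
    intro x y hne hxy
    have hyx : y * x = x := by rw [hcomm, hxy]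
    by_cases hz : ∃ z, x * z = x ∧ z * y = z ∧ z ≠ x ∧ z ≠ y
    · obtain ⟨z, hxz, hzy, hzx, hzy'⟩ := hz
      have h1 : ∀ᶠ a in 𝓝 x, z * a ≠ z :=
        (isOpen_ne_fun (hcont z) continuous_const).mem_nhds
          (by simpa [hcomm z x, hxz] using hzx.symm)
      have h2 : ∀ᶠ b in 𝓝 y, z * b ≠ b :=
        (isOpen_ne_fun (hcont z) continuous_id).mem_nhds (by simpa [hzy] using hzy')
      filter_upwards [h1.prod_inl_nhds y, h2.prod_inr_nhds x] with p hp hp'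
      have ha := (hlin z p.1).resolve_left hp
      have hb := (hlin z p.2).resolve_right hp'
      calc p.1 * p.2 = z * p.1 * p.2 := by rw [ha]
        _ = p.1 * (z * p.2) := by rw [hcomm z, hassoc]
        _ = p.1 := by rw [hb, hcomm, ha]
    · have h1 : ∀ᶠ a in 𝓝 x, y * a ≠ y :=
        (isOpen_ne_fun (hcont y) continuous_const).mem_nhds (by simpa [hyx] using hne)
      have h2 : ∀ᶠ b in 𝓝 y, x * b ≠ b :=
        (isOpen_ne_fun (hcont x) continuous_id).mem_nhds (by simpa [hxy] using hne)
      filter_upwards [h1.prod_inl_nhds y, h2.prod_inr_nhds x] with p hp hp'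
      have ha := (hlin y p.1).resolve_left hp
      have hb := (hlin x p.2).resolve_right hp'
      have hax : x * p.1 = p.1 := by
        by_cases hpx : p.1 = x
        · rw [hpx, hidem]
        · refine (hlin x p.1).resolve_left fun hx => ?_
          exact hz ⟨p.1, hx, by rw [hcomm, ha], hpx, fun h => hp (by rw [h, hidem])⟩
      calc p.1 * p.2 = x * p.1 * p.2 := by rw [hax]
        _ = p.1 * (x * p.2) := by rw [hcomm x, hassoc]
        _ = p.1 := by rw [hb, hcomm, hax]
  refine continuous_iff_continuousAt.2 fun ⟨x, y⟩ => ?_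
  by_cases hne : x = y
  · subst hne
    intro U hU
    simp only [hidem] at hU
    refine mem_map.2 <| mem_of_superset (prod_mem_nhds hU hU) fun p hp => ?_
    rcases hlin p.1 p.2 with h | h
    · simpa [h] using hp.1
    · simpa [h] using hp.2
  · rcases hlin x y with hxy | hxy
    · exact continuousAt_fst.congr ((hlt x y hne hxy).mono fun _ h => h.symm)
    · have hsw : ∀ᶠ p : E × E in 𝓝 (x, y), p.2 * p.1 = p.2 :=
        (continuous_swap.tendsto (x, y)).eventually
          (hlt y x (Ne.symm hne) (by rw [hcomm, hxy]))
      exact continuousAt_snd.congr (hsw.mono fun p h => h.symm.trans (hcomm _ _))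

/-- In a linearly ordered `H`-closed semitopological semilattice, the up-set
`↑e = {x | e ≤ x} = {x | e * x = e}` and the down-set
`↓e = {x | x ≤ e} = {x | x * e = x}`, with the subspace topology, are topological
semilattices which are absolutely `H`-closed in the class of semitopological
semilattices. -/
theorem stmt14 {E : Type u} [Mul E] [TopologicalSpace E]
    (hE : IsSemitopologicalSemilattice E)
    (hlin : ∀ x y : E, x * y = x ∨ x * y = y)
    (hH : HClosedInSemitopSemilattices E) (e : E) :
    (Continuous fun p : {x : E // e * x = e} × {x : E // e * x = e} =>
        ((p.1 : E) * (p.2 : E))) ∧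
      (∀ (T : Type u) [Mul T] [TopologicalSpace T], IsSemitopologicalSemilattice T →
        ∀ h : {x : E // e * x = e} → T, Continuous h →
          (∀ (x y : {x : E // e * x = e}) (hxy : e * ((x : E) * (y : E)) = e),
            h ⟨(x : E) * (y : E), hxy⟩ = h x * h y) →
          IsClosed (Set.range h)) ∧
      (Continuous fun p : {x : E // x * e = x} × {x : E // x * e = x} =>
        ((p.1 : E) * (p.2 : E))) ∧
      ∀ (T : Type u) [Mul T] [TopologicalSpace T], IsSemitopologicalSemilattice T →
        ∀ h : {x : E // x * e = x} → T, Continuous h →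
          (∀ (x y : {x : E // x * e = x})
              (hxy : (x : E) * (y : E) * e = (x : E) * (y : E)),
            h ⟨(x : E) * (y : E), hxy⟩ = h x * h y) →
          IsClosed (Set.range h) := by
  have hmul := continuous_mul_of_linear hE hlin
  have hE' := hE
  obtain ⟨⟨hassoc, hcomm, hidem⟩, hT2, hcont⟩ := hE'
  refine ⟨hmul.comp (continuous_subtype_val.prodMap continuous_subtype_val), ?_,
    hmul.comp (continuous_subtype_val.prodMap continuous_subtype_val), ?_⟩
  · intro T _ _ hT h hc hh
    classical
    obtain ⟨r, hr, hr'⟩ : ∃ r : E → E, (∀ x, e * x = e → r x = x) ∧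
        ∀ x, e * x = x → r x = e :=
      ⟨fun x => if e * x = e then x else e, fun x hx => by simp [hx],
        fun x hx => by simp only [hx]; split_ifs with h1 <;> [exact h1; rfl]⟩
    have hre : ∀ x, e * r x = e := by
      intro x
      rcases hlin e x with hx | hx
      · rw [hr x hx, hx]
      · rw [hr' x hx, hidem]
    have hrc : Continuous r := by
      have hcl : IsClosed {x | e * x = e} := isClosed_eq (hcont e) continuous_const
      have hcl' : IsClosed {x | e * x = x} := isClosed_eq (hcont e) continuous_id
      rw [← continuousOn_univ, ← Set.eq_univ_of_forall (s := {x | e * x = e} ∪ {x | e * x = x})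
        (hlin e)]
      exact (continuousOn_id.congr hr).union_of_isClosed (continuousOn_const.congr hr') hcl hcl'
    have hrm : ∀ x y, r (x * y) = r x * r y := by
      intro x y
      rcases hlin e x with hx | hx <;> rcases hlin e y with hy | hy
      · rw [hr x hx, hr y hy, hr _ (by rw [← hassoc, hx, hy])]
      · rw [hr x hx, hr' y hy, hr' _ (by rw [hcomm x, ← hassoc, hy]), hcomm, hx]
      · rw [hr' x hx, hr y hy, hr' _ (by rw [← hassoc, hx]), hy]
      · rw [hr' x hx, hr' y hy, hr' _ (by rw [← hassoc, hx]), hidem]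
    have hcl := isClosed_range_of_hClosed hE hlin hH hT
      (fun x => h ⟨r x, hre x⟩) (hc.comp (hrc.subtype_mk hre)) fun x y => by
        simp only [hrm]
        exact hh ⟨r x, hre x⟩ ⟨r y, hre y⟩ _
    convert hcl using 1
    refine Set.Subset.antisymm ?_ ?_
    · rintro _ ⟨⟨x, hx⟩, rfl⟩
      exact ⟨x, by simp only [hr x hx]⟩
    · rintro _ ⟨x, rfl⟩
      exact ⟨_, rfl⟩
  · intro T _ _ hT h hc hh
    have hre : ∀ x, e * x * e = e * x := fun x => by rw [hcomm, ← hassoc, hidem]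
    have hrm : ∀ x y, e * (x * y) = e * x * (e * y) := fun x y => by
      rw [← hassoc (e * x), hre, hassoc]
    have hcl := isClosed_range_of_hClosed hE hlin hH hT
      (fun x => h ⟨e * x, hre x⟩) (hc.comp ((hcont e).subtype_mk hre)) fun x y => by
        simp only [hrm]
        exact hh ⟨e * x, hre x⟩ ⟨e * y, hre y⟩ _
    convert hcl using 1
    refine Set.Subset.antisymm ?_ ?_
    · rintro _ ⟨⟨x, hx⟩, rfl⟩
      exact ⟨x, by simp only [hcomm e x, hx]⟩
    · rintro _ ⟨x, rfl⟩
      exact ⟨_, rfl⟩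
end

section
/- Let S be a Hausdorff semitopological inverse monoid with zero and continuous inversion. Then the following are equivalent: (i) S is H-closed in the class of semitopological inverse semigroups with continuous inversion; (ii) there exists a cardinal λ ≥ 2 such that every topological Brandt λ⁰-extension of S in this class is H-closed in this class; (iii) for every cardinal λ ≥ 2, every topological Brandt λ⁰-extension of S in this class is H-closed in this class. -/
open Topology

universe u v

/-- `i` is the inversion map of an inverse semigroup: every `x` has `i x` as its
unique inverse element (`x * i x * x = x`, `i x * x * i x = i x`). -/
def IsInvOf {S : Type u} [Mul S] (i : S → S) : Prop :=
  ∀ x : S, (x * i x * x = x ∧ i x * x * i x = i x) ∧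
    ∀ y : S, x * y * x = x → y * x * y = y → y = i x

/-- A (Hausdorff) semitopological semigroup: an associative multiplication on a
Hausdorff topological space which is separately continuous. -/
def IsSemitopologicalSemigroup (S : Type u) [Mul S] [TopologicalSpace S] : Prop :=
  (∀ x y z : S, x * y * z = x * (y * z)) ∧ T2Space S ∧
    (∀ a : S, Continuous fun x : S => a * x) ∧ (∀ a : S, Continuous fun x : S => x * a)

/-- Membership in the class of semitopological inverse semigroups with continuous
inversion, the inversion map being `i`. -/
def IsSTISWCI {S : Type u} [Mul S] [TopologicalSpace S] (i : S → S) : Prop :=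
  IsSemitopologicalSemigroup S ∧ IsInvOf i ∧ Continuous i

/-- `S` is absolutely `H`-closed in the class of semitopological inverse semigroups
with continuous inversion: every continuous homomorphic image of `S` in a member of
the class is closed. -/
def AbsHClosedSTIS (S : Type u) [Mul S] [TopologicalSpace S] : Prop :=
  ∀ (T : Type u) [Mul T] [TopologicalSpace T] (iT : T → T), IsSTISWCI iT →
    ∀ h : S → T, Continuous h → (∀ x y : S, h (x * y) = h x * h y) →
      IsClosed (Set.range h)

/-- `S` is `H`-closed in the class of semitopological inverse semigroups with
continuous inversion: the image of `S` under any homomorphic topological embedding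
into a member of the class is closed. -/
def HClosedSTIS (S : Type u) [Mul S] [TopologicalSpace S] : Prop :=
  ∀ (T : Type u) [Mul T] [TopologicalSpace T] (iT : T → T), IsSTISWCI iT →
    ∀ h : S → T, (∀ x y : S, h (x * y) = h x * h y) → IsEmbedding h →
      IsClosed (Set.range h)

/-- The carrier of the Brandt `λ⁰`-extension `B⁰_λ(S)` of a monoid `S` with zero:
the elements `(α, s, β)` with `s ∈ S \ {0}` together with a zero element. -/
inductive BrandtCarrier (lam : Type u) (S : Type u) [MonoidWithZero S] : Type u
  | zero : BrandtCarrier lam S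
  | elt : lam → {s : S // s ≠ 0} → lam → BrandtCarrier lam S

/-- Multiplication of the Brandt `λ⁰`-extension:
`(α,a,β)·(γ,b,δ) = (α, a*b, δ)` if `β = γ` and `a*b ≠ 0`, and `0` otherwise. -/
noncomputable instance {lam S : Type u} [MonoidWithZero S] :
    Mul (BrandtCarrier lam S) :=
  ⟨fun x y =>
    match x, y with
    | .elt a s b, .elt c t d =>
        letI := Classical.propDecidable (b = c ∧ (s : S) * (t : S) ≠ 0)
        if h : b = c ∧ (s : S) * (t : S) ≠ 0 then .elt a ⟨(s : S) * (t : S), h.2⟩ d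
        else .zero
    | _, _ => .zero⟩

/-- The natural inclusion `S → B⁰_λ(S)`, `s ↦ (α, s, α)` for `s ≠ 0`, `0 ↦ 0`. -/
noncomputable def brandtEmb {lam S : Type u} [MonoidWithZero S] (a : lam) (s : S) :
    BrandtCarrier lam S :=
  letI := Classical.propDecidable (s = 0)
  if h : s = 0 then .zero else .elt a ⟨s, h⟩ a

/-- `tB` is a topological Brandt `λ⁰`-extension of `S` in the class of
semitopological inverse semigroups with continuous inversion, with inversion `iB`:
the extension belongs to the class and for some `α ∈ λ` the subspace `S_{α,α}` is
naturally homeomorphic to `S`. -/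
def IsTopBrandtExt {lam S : Type u} [MonoidWithZero S] [TopologicalSpace S]
    (tB : TopologicalSpace (BrandtCarrier lam S))
    (iB : BrandtCarrier lam S → BrandtCarrier lam S) : Prop :=
  letI := tB
  IsSTISWCI iB ∧ ∃ a : lam, IsEmbedding (brandtEmb (lam := lam) (S := S) a)

/-- A homomorphism of inverse semigroups preserves inverses. -/
lemma IsInvOf.map {A B : Type u} [Mul A] [Mul B] {iA : A → A} {iB : B → B}
    (hA : IsInvOf iA) (hB : IsInvOf iB) {f : A → B} (hf : ∀ x y, f (x * y) = f x * f y)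
    (x : A) : f (iA x) = iB (f x) := by
  refine (hB (f x)).2 _ ?_ ?_
  · rw [← hf, ← hf, (hA x).1.1]
  · rw [← hf, ← hf, (hA x).1.2]

/-- An inverse semigroup with the topology induced by an injective homomorphism into a
semitopological inverse semigroup with continuous inversion is of the same kind. -/
lemma IsSTISWCI.of_isEmbedding {A B : Type u} [Mul A] [Mul B] [TopologicalSpace A]
    [TopologicalSpace B] {iA : A → A} {iB : B → B} (hA : IsInvOf iA) (hB : IsSTISWCI iB)
    {f : A → B} (hf : ∀ x y, f (x * y) = f x * f y) (he : IsEmbedding f) : IsSTISWCI iA := by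
  obtain ⟨⟨hassoc, hT2, hl, hr⟩, hinv, hcont⟩ := hB
  refine ⟨⟨fun x y z => he.injective ?_, he.t2Space, fun a => ?_, fun a => ?_⟩, hA, ?_⟩
  · simp only [hf, hassoc]
  · simpa only [he.continuous_iff, Function.comp_def, hf] using (hl (f a)).comp he.continuous
  · simpa only [he.continuous_iff, Function.comp_def, hf] using (hr (f a)).comp he.continuous
  · simpa only [he.continuous_iff, Function.comp_def, hA.map hinv hf] using
      hcont.comp he.continuous

/-- The closure of a subset closed under multiplication is closed under multiplication. -/
lemma IsSemitopologicalSemigroup.mul_mem_closure {T : Type u} [Mul T] [TopologicalSpace T]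
    (hT : IsSemitopologicalSemigroup T) {s : Set T} (hs : ∀ x ∈ s, ∀ y ∈ s, x * y ∈ s)
    {x y : T} (hx : x ∈ closure s) (hy : y ∈ closure s) : x * y ∈ closure s := by
  have hleft : ∀ z ∈ s, z * y ∈ closure s := fun z hz =>
    map_mem_closure (hT.2.2.1 z) hy (hs z hz)
  simpa only [closure_closure] using map_mem_closure (hT.2.2.2 y) hx hleft

/-- The closure of the image of a homomorphism of inverse semigroups is closed under
inversion, provided the latter is continuous. -/
lemma IsSTISWCI.inv_mem_closure_range {S T : Type u} [Mul S] [Mul T] [TopologicalSpace T]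
    {iS : S → S} {iT : T → T} (hS : IsInvOf iS) (hT : IsSTISWCI iT) {h : S → T}
    (hh : ∀ x y, h (x * y) = h x * h y) {x : T} (hx : x ∈ closure (Set.range h)) :
    iT x ∈ closure (Set.range h) :=
  map_mem_closure hT.2.2 hx <| by
    rintro _ ⟨s, rfl⟩
    exact ⟨iS s, hS.map hT.2.1 hh s⟩

/-- To check `H`-closedness of a monoid with zero it suffices to consider embeddings into
monoids with zero that preserve zero. -/
lemma hClosedSTIS_of_monoidWithZero {S : Type u} [MonoidWithZero S] [TopologicalSpace S]
    {iS : S → S} (hS : IsInvOf iS)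
    (H : ∀ (T : Type u) [MonoidWithZero T] [TopologicalSpace T] (iT : T → T), IsSTISWCI iT →
      ∀ h : S → T, (∀ x y, h (x * y) = h x * h y) → h 0 = 0 → IsEmbedding h →
        IsClosed (Set.range h)) : HClosedSTIS S := by
  intro T _ _ iT hT h hh he
  have hT2 : T2Space T := hT.1.2.1
  have hl := hT.1.2.2.1
  have hr := hT.1.2.2.2
  have hmul : ∀ {x y : T}, x ∈ closure (Set.range h) → y ∈ closure (Set.range h) →
      x * y ∈ closure (Set.range h) := by
    refine hT.1.mul_mem_closure ?_
    rintro _ ⟨x, rfl⟩ _ ⟨y, rfl⟩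
    exact ⟨x * y, hh x y⟩
  have closure_ind : ∀ f g : T → T, Continuous f → Continuous g → (∀ s, f (h s) = g (h s)) →
      ∀ x ∈ closure (Set.range h), f x = g x := fun f g hf hg hfg x hx =>
    closure_minimal (by rintro _ ⟨s, rfl⟩; exact hfg s) (isClosed_eq hf hg) hx
  have mem : ∀ s, h s ∈ closure (Set.range h) := fun s => subset_closure ⟨s, rfl⟩
  let : MonoidWithZero (closure (Set.range h)) :=
    { mul := fun x y => ⟨x.1 * y.1, hmul x.2 y.2⟩
      one := ⟨h 1, mem 1⟩
      zero := ⟨h 0, mem 0⟩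
      mul_assoc := fun x y z => Subtype.ext (hT.1.1 _ _ _)
      one_mul := fun x => Subtype.ext <| closure_ind _ _ (hl _) continuous_id
        (fun s => (hh _ _).symm.trans (by rw [one_mul, id])) x.1 x.2
      mul_one := fun x => Subtype.ext <| closure_ind _ _ (hr _) continuous_id
        (fun s => (hh _ _).symm.trans (by rw [mul_one, id])) x.1 x.2
      zero_mul := fun x => Subtype.ext <| closure_ind _ (fun _ => h 0) (hl _) continuous_const
        (fun s => (hh _ _).symm.trans (by rw [zero_mul])) x.1 x.2
      mul_zero := fun x => Subtype.ext <| closure_ind _ (fun _ => h 0) (hr _) continuous_const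
        (fun s => (hh _ _).symm.trans (by rw [mul_zero])) x.1 x.2 }
  have hinv : IsInvOf fun x : closure (Set.range h) =>
      (⟨iT x.1, hT.inv_mem_closure_range hS hh x.2⟩ : closure (Set.range h)) := fun x =>
    ⟨⟨Subtype.ext (hT.2.1 x.1).1.1, Subtype.ext (hT.2.1 x.1).1.2⟩, fun y h₁ h₂ =>
      Subtype.ext ((hT.2.1 x.1).2 y.1 (congrArg Subtype.val h₁) (congrArg Subtype.val h₂))⟩
  have hcl := H (closure (Set.range h)) _
    (IsSTISWCI.of_isEmbedding hinv hT (fun _ _ => rfl) IsEmbedding.subtypeVal)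
    (fun s => ⟨h s, mem s⟩) (fun x y => Subtype.ext (hh x y)) rfl
    (IsEmbedding.of_comp (by fun_prop (disch := exact he.continuous)) continuous_subtype_val he)
  have himage : Subtype.val '' Set.range (fun s => (⟨h s, mem s⟩ : closure (Set.range h))) =
      Set.range h := by
    rw [← Set.range_comp]
    rfl
  rw [← himage]
  exact isClosed_closure.isClosedEmbedding_subtypeVal.isClosedMap _ hcl

namespace BrandtCarrier

variable {lam S T : Type u} [MonoidWithZero S] [MonoidWithZero T]

open Classical in
/-- The map `S → B⁰_λ(S)`, `s ↦ (a, s, b)` for `s ≠ 0`, `0 ↦ 0`. -/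
noncomputable def incl (a b : lam) (s : S) : BrandtCarrier lam S :=
  if h : s = 0 then .zero else .elt a ⟨s, h⟩ b

@[simp] lemma incl_zero (a b : lam) : incl a b (0 : S) = zero := by simp [incl]

lemma elt_eq_incl (a b : lam) (s : {s : S // s ≠ 0}) : elt a s b = incl a b s.1 := by
  simp [incl, s.2]

lemma eq_zero_or_incl (x : BrandtCarrier lam S) :
    x = zero ∨ ∃ a b s, x = incl a b s := by
  rcases x with _ | ⟨a, s, b⟩
  · exact .inl rfl
  · exact .inr ⟨a, b, s, elt_eq_incl a b s⟩

@[simp] lemma zero_mul' (x : BrandtCarrier lam S) : zero * x = zero := by cases x <;> rfl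

@[simp] lemma mul_zero' (x : BrandtCarrier lam S) : x * zero = zero := by cases x <;> rfl

open Classical in
lemma elt_mul_elt (a b c d : lam) (s t : {s : S // s ≠ 0}) :
    elt a s b * elt c t d = if b = c then incl a d (s.1 * t.1) else zero := by
  have hmul : elt a s b * elt c t d = @dite _ (b = c ∧ s.1 * t.1 ≠ 0) (propDecidable _)
      (fun h => elt a ⟨s.1 * t.1, h.2⟩ d) (fun _ => zero) := rfl
  rw [hmul]
  by_cases hbc : b = c <;> by_cases hst : s.1 * t.1 = 0 <;> simp [hbc, hst, incl]

open Classical in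
lemma incl_mul_incl (a b c d : lam) (s t : S) :
    incl a b s * incl c d t = if b = c then incl a d (s * t) else zero := by
  by_cases hs : s = 0
  · simp [hs]
  by_cases ht : t = 0
  · simp [ht]
  rw [← elt_eq_incl a b ⟨s, hs⟩, ← elt_eq_incl c d ⟨t, ht⟩, elt_mul_elt]

@[simp] lemma incl_mul_incl_same (a b d : lam) (s t : S) :
    incl a b s * incl b d t = incl a d (s * t) := by
  simp [incl_mul_incl]

lemma incl_mul_incl_of_ne {a b c d : lam} (h : b ≠ c) (s t : S) :
    incl a b s * incl c d t = zero := by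
  simp [incl_mul_incl, h]

protected lemma mul_assoc (x y z : BrandtCarrier lam S) : x * y * z = x * (y * z) := by
  obtain rfl | ⟨a, b, s, rfl⟩ := eq_zero_or_incl x
  · simp
  obtain rfl | ⟨c, d, t, rfl⟩ := eq_zero_or_incl y
  · simp
  obtain rfl | ⟨e, f, u, rfl⟩ := eq_zero_or_incl z
  · simp
  by_cases hbc : b = c <;> by_cases hde : d = e <;>
    simp [incl_mul_incl, hbc, hde, mul_assoc]

open Classical in
/-- The `(a, b)` coordinate `B⁰_λ(S) → S`. -/
noncomputable def coord (a b : lam) : BrandtCarrier lam S → S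
  | zero => 0
  | elt c s d => if c = a ∧ d = b then s.1 else 0

@[simp] lemma coord_zero (a b : lam) : coord a b (zero : BrandtCarrier lam S) = 0 := rfl

open Classical in
lemma coord_incl (a b c d : lam) (s : S) :
    coord a b (incl c d s) = if c = a ∧ d = b then s else 0 := by
  by_cases hs : s = 0
  · simp [hs]
  · rw [← elt_eq_incl c d ⟨s, hs⟩, coord]

@[simp] lemma coord_incl_same (a b : lam) (s : S) : coord a b (incl a b s) = s := by
  simp [coord_incl]

lemma incl_injective (a b : lam) : Function.Injective (incl (S := S) a b) :=
  Function.LeftInverse.injective (coord_incl_same a b)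

lemma ext_coord {x y : BrandtCarrier lam S} (h : ∀ a b, coord a b x = coord a b y) : x = y := by
  rcases x with _ | ⟨a, s, b⟩
  · rcases y with _ | ⟨c, t, d⟩
    · rfl
    · exact absurd (by simpa [coord] using (h c d).symm) t.2
  · have hs := h a b
    rcases y with _ | ⟨c, t, d⟩
    · exact absurd (by simpa [coord] using hs) s.2
    · by_cases hcd : c = a ∧ d = b
      · obtain ⟨rfl, rfl⟩ := hcd
        simp only [coord, and_self, if_true] at hs
        rw [Subtype.ext hs]
      · exact absurd (by simpa [coord, hcd] using hs) s.2

lemma incl_mul_mul_incl (a b c d : lam) (s t : S) (x : BrandtCarrier lam S) :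
    incl a c s * x * incl d b t = incl a b (s * coord c d x * t) := by
  obtain rfl | ⟨e, f, u, rfl⟩ := eq_zero_or_incl x
  · simp
  by_cases hce : e = c <;> by_cases hdf : f = d
  · subst hce hdf; simp
  · subst hce; simp [incl_mul_incl, coord_incl, hdf]
  · simp [incl_mul_incl, coord_incl, hce, Ne.symm hce]
  · simp [incl_mul_incl, coord_incl, hce, Ne.symm hce]

/-- The inversion of the Brandt extension. -/
noncomputable def inv (i : S → S) : BrandtCarrier lam S → BrandtCarrier lam S
  | zero => zero
  | elt a s b => incl b a (i s)

lemma inv_incl {i : S → S} (hi : i 0 = 0) (a b : lam) (s : S) :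
    inv i (incl a b s) = incl b a (i s) := by
  by_cases hs : s = 0
  · simp [hs, hi, inv]
  · rw [← elt_eq_incl a b ⟨s, hs⟩, inv]

lemma isInvOf_inv {i : S → S} (hi : IsInvOf i) : IsInvOf (inv (lam := lam) i) := by
  intro x
  rcases x with _ | ⟨a, s, b⟩
  · refine ⟨by simp [inv], fun y _ hy => ?_⟩
    simpa [inv] using hy.symm
  · rw [inv, elt_eq_incl]
    refine ⟨by simp [(hi s.1).1], fun y h₁ h₂ => ?_⟩
    have h₁' := incl_injective a b ((incl_mul_mul_incl a b b a s.1 s.1 y).symm.trans h₁)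
    obtain rfl | ⟨c, d, t, rfl⟩ := eq_zero_or_incl y
    · exact absurd (by simpa using h₁'.symm) s.2
    · by_cases hcd : c = b ∧ d = a
      · obtain ⟨rfl, rfl⟩ := hcd
        simp only [incl_mul_incl_same] at h₂
        rw [coord_incl_same] at h₁'
        rw [(hi s.1).2 t h₁' (incl_injective _ _ h₂)]
      · exact absurd (by simpa [coord_incl, hcd] using h₁'.symm) s.2

/-- The map of Brandt extensions induced by a map of monoids with zero. -/
noncomputable def map (h : S → T) : BrandtCarrier lam S → BrandtCarrier lam T
  | zero => zero
  | elt a s b => incl a b (h s)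

@[simp] lemma map_zero (h : S → T) : map h (zero : BrandtCarrier lam S) = zero := rfl

lemma map_incl {h : S → T} (h0 : h 0 = 0) (a b : lam) (s : S) :
    map h (incl a b s) = incl a b (h s) := by
  by_cases hs : s = 0
  · simp [hs, h0]
  · rw [← elt_eq_incl a b ⟨s, hs⟩, map]

lemma coord_map {h : S → T} (h0 : h 0 = 0) (a b : lam) (x : BrandtCarrier lam S) :
    coord a b (map h x) = h (coord a b x) := by
  obtain rfl | ⟨c, d, s, rfl⟩ := eq_zero_or_incl x
  · simp [h0]
  · rw [map_incl h0, coord_incl, coord_incl]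
    split_ifs <;> simp [h0]

lemma map_mul {h : S → T} (h0 : h 0 = 0) (hh : ∀ x y, h (x * y) = h x * h y)
    (x y : BrandtCarrier lam S) : map h (x * y) = map h x * map h y := by
  obtain rfl | ⟨a, b, s, rfl⟩ := eq_zero_or_incl x
  · simp
  obtain rfl | ⟨c, d, t, rfl⟩ := eq_zero_or_incl y
  · simp
  by_cases hbc : b = c
  · subst hbc; simp [map_incl h0, hh]
  · simp [map_incl h0, incl_mul_incl_of_ne hbc]

lemma map_injective {h : S → T} (h0 : h 0 = 0) (hinj : Function.Injective h) :
    Function.Injective (map (lam := lam) h) := fun x y hxy =>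
  ext_coord fun a b => hinj <| by rw [← coord_map h0, ← coord_map h0, hxy]

/-- The finest topology on the Brandt extension for which all inclusions
`s ↦ (a, s, b)` are continuous. -/
noncomputable abbrev topology (lam S : Type u) [MonoidWithZero S] [t : TopologicalSpace S] :
    TopologicalSpace (BrandtCarrier lam S) :=
  ⨆ p : lam × lam, t.coinduced (incl p.1 p.2)

section Topology

variable [TopologicalSpace S]

attribute [local instance] topology

lemma continuous_dom_iff {X : Type*} [TopologicalSpace X] {f : BrandtCarrier lam S → X} :
    Continuous f ↔ ∀ a b, Continuous fun s => f (incl a b s) := by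
  rw [topology, continuous_iSup_dom, Prod.forall]
  exact forall₂_congr fun a b => continuous_coinduced_dom

lemma continuous_incl (a b : lam) : Continuous (incl (S := S) a b) :=
  continuous_dom_iff.1 continuous_id a b

lemma continuous_coord (a b : lam) : Continuous (coord (S := S) a b) := by
  classical
  refine continuous_dom_iff.2 fun c d => ?_
  simp only [coord_incl]
  split_ifs
  · exact continuous_id
  · exact continuous_const

lemma isEmbedding_incl (a b : lam) : IsEmbedding (incl (S := S) a b) :=
  IsEmbedding.of_leftInverse (coord_incl_same a b) (continuous_coord a b) (continuous_incl a b)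

lemma isSTISWCI_inv {i : S → S} (hi : IsSTISWCI i) : IsSTISWCI (inv (lam := lam) i) := by
  classical
  obtain ⟨⟨-, hT2, hl, hr⟩, hinv, hcont⟩ := hi
  have hi0 : i 0 = 0 := ((hinv 0).2 0 (by simp) (by simp)).symm
  refine ⟨⟨BrandtCarrier.mul_assoc, ⟨fun x y hxy => ?_⟩, fun x => ?_, fun x => ?_⟩,
    isInvOf_inv hinv, ?_⟩
  · obtain ⟨a, b, hab⟩ : ∃ a b, coord a b x ≠ coord a b y := by
      by_contra! h
      exact hxy (ext_coord h)
    exact separated_by_continuous (continuous_coord a b) hab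
  · obtain rfl | ⟨a, b, s, rfl⟩ := eq_zero_or_incl x
    · simpa only [zero_mul'] using continuous_const
    refine continuous_dom_iff.2 fun c d => ?_
    simp only [incl_mul_incl]
    split_ifs
    · exact (continuous_incl a d).comp (hl s)
    · exact continuous_const
  · obtain rfl | ⟨a, b, s, rfl⟩ := eq_zero_or_incl x
    · simpa only [mul_zero'] using continuous_const
    refine continuous_dom_iff.2 fun c d => ?_
    simp only [incl_mul_incl]
    split_ifs
    · exact (continuous_incl c b).comp (hr s)
    · exact continuous_const
  · refine continuous_dom_iff.2 fun a b => ?_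
    simp only [inv_incl hi0]
    exact (continuous_incl b a).comp hcont

end Topology

end BrandtCarrier

open BrandtCarrier in
/-- A topological Brandt extension of an `H`-closed monoid is `H`-closed. -/
lemma HClosedSTIS.of_isTopBrandtExt {lam S : Type u} [MonoidWithZero S] [TopologicalSpace S]
    (hS : HClosedSTIS S) (tB : TopologicalSpace (BrandtCarrier lam S))
    {iB : BrandtCarrier lam S → BrandtCarrier lam S} (hB : IsTopBrandtExt tB iB) :
    HClosedSTIS (BrandtCarrier lam S) := by
  intro T _ _ iT hT h hh he
  obtain ⟨hB, a, ha⟩ := hB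
  have hT2 : T2Space T := hT.1.2.1
  have hassoc := hT.1.1
  have hl := hT.1.2.2.1
  have hr := hT.1.2.2.2
  have hcl : IsClosed (Set.range fun s : S => h (incl a a s)) :=
    hS T iT hT _ (fun x y => by rw [← hh, incl_mul_incl_same]) (he.comp ha)
  refine isClosed_of_closure_subset fun t ht => ?_
  have sandwich : ∀ b c, ∃ s : S, h (incl a b 1) * t * h (incl c a 1) = h (incl a a s) := by
    intro b c
    have hmem := map_mem_closure ((hr (h (incl c a 1))).comp (hl (h (incl a b 1)))) ht
      (t := Set.range fun s : S => h (incl a a s)) ?_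
    · rw [hcl.closure_eq] at hmem
      exact hmem.imp fun s hs => hs.symm
    · rintro _ ⟨x, rfl⟩
      exact ⟨1 * coord b c x * 1, by simp only [Function.comp_apply, ← hh, incl_mul_mul_incl]⟩
  by_cases hne : ∃ b c, h (incl a b 1) * t * h (incl c a 1) ≠ h zero
  · obtain ⟨b, c, hbc⟩ := hne
    have hopen : IsOpen {x | h (incl a b 1) * x * h (incl c a 1) ≠ h zero} :=
      isOpen_ne.preimage ((hr (h (incl c a 1))).comp (hl (h (incl a b 1))))
    have hfix : t = h (incl b a 1) * (h (incl a b 1) * t * h (incl c a 1)) * h (incl a c 1) := by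
      refine closure_minimal ?_ (isClosed_eq continuous_id
        ((hr (h (incl a c 1))).comp ((hl (h (incl b a 1))).comp
          ((hr (h (incl c a 1))).comp (hl (h (incl a b 1))))))) (hopen.inter_closure ⟨hbc, ht⟩)
      rintro _ ⟨hx, x, rfl⟩
      simp only [Set.mem_ofPred_eq, Function.comp_apply, id, ← hh, incl_mul_mul_incl,
        one_mul, mul_one, coord_incl_same] at hx ⊢
      congr 1
      obtain rfl | ⟨d, e, s, rfl⟩ := eq_zero_or_incl x
      · simp
      by_cases hde : d = b ∧ e = c
      · obtain ⟨rfl, rfl⟩ := hde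
        rw [coord_incl_same]
      · simp [coord_incl, hde] at hx
    obtain ⟨s, hs⟩ := sandwich b c
    rw [hs, ← hh, ← hh] at hfix
    exact ⟨_, hfix.symm⟩
  · push Not at hne
    have zero_on_closure : ∀ f : T → T, Continuous f → (∀ x, f (h x) = h zero) →
        ∀ x ∈ closure (Set.range h), f x = h zero := fun f hf hfh x hx =>
      closure_minimal (by rintro _ ⟨y, rfl⟩; exact hfh y)
        (isClosed_eq hf continuous_const) hx
    have hzero : ∀ x ∈ closure (Set.range h), x * h zero = h zero :=
      zero_on_closure _ (hr _) fun x => by rw [← hh, mul_zero']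
    have hzero' : ∀ x ∈ closure (Set.range h), h zero * x = h zero :=
      zero_on_closure _ (hl _) fun x => by rw [← hh, zero_mul']
    have hit : iT t ∈ closure (Set.range h) := hT.inv_mem_closure_range hB.2.1 hh ht
    have row_mul : ∀ b, ∀ x ∈ closure (Set.range h), h (incl a b 1) * t * x = h zero := by
      intro b
      refine zero_on_closure _ (hl _) fun x => ?_
      obtain rfl | ⟨c, d, s, rfl⟩ := eq_zero_or_incl x
      · rw [hassoc, hzero t ht, ← hh, mul_zero']
      · have hfac : incl c d s = incl c a 1 * incl a d s := by simp
        rw [hfac, hh, ← hassoc, hne, ← hh, zero_mul']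
    have row : ∀ b, h (incl a b 1) * t = h zero := by
      intro b
      have hcalc : h (incl a b 1) * t * iT t * t = h (incl a b 1) * t := by
        rw [hassoc, hassoc, ← hassoc t, (hT.2.1 t).1.1]
      rw [← hcalc, row_mul b _ hit, hzero' t ht]
    have all : ∀ x ∈ closure (Set.range h), x * t = h zero := by
      refine zero_on_closure _ (hr t) fun x => ?_
      obtain rfl | ⟨c, d, s, rfl⟩ := eq_zero_or_incl x
      · exact hzero' t ht
      · have hfac : incl c d s = incl c a s * incl a d 1 := by simp
        rw [hfac, hh, hassoc, row, ← hh, mul_zero']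
    refine ⟨zero, ?_⟩
    rw [← (hT.2.1 t).1.1, hassoc, all _ hit, hzero t ht]

open BrandtCarrier in
/-- A monoid is `H`-closed if all its topological Brandt extensions are. -/
lemma hClosedSTIS_of_forall_isTopBrandtExt {lam S : Type u} [Nonempty lam] [MonoidWithZero S]
    [TopologicalSpace S] {iS : S → S} (hS : IsInvOf iS)
    (H : ∀ (tB : TopologicalSpace (BrandtCarrier lam S))
      (iB : BrandtCarrier lam S → BrandtCarrier lam S),
      IsTopBrandtExt tB iB → HClosedSTIS (BrandtCarrier lam S)) : HClosedSTIS S := by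
  refine hClosedSTIS_of_monoidWithZero hS fun T _ _ iT hT h hh h0 he => ?_
  obtain ⟨a⟩ := ‹Nonempty lam›
  let tT : TopologicalSpace (BrandtCarrier lam T) := topology lam T
  let tB : TopologicalSpace (BrandtCarrier lam S) := tT.induced (map h)
  have hmap : IsEmbedding (map (lam := lam) h) := ⟨⟨rfl⟩, map_injective h0 he.injective⟩
  have hcomp : map (lam := lam) h ∘ brandtEmb a = incl a a ∘ h :=
    funext fun s => map_incl h0 a a s
  have hB : IsTopBrandtExt tB (inv iS) :=
    ⟨IsSTISWCI.of_isEmbedding (isInvOf_inv hS) (isSTISWCI_inv hT) (map_mul h0 hh) hmap,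
      a, hmap.of_comp_iff.1 (hcomp ▸ (isEmbedding_incl a a).comp he)⟩
  have hcl := (H tB _ hB _ _ (isSTISWCI_inv hT) _ (map_mul h0 hh) hmap).preimage
    (continuous_incl a a)
  convert hcl using 1
  ext t
  constructor
  · rintro ⟨s, rfl⟩
    exact ⟨incl a a s, map_incl h0 a a s⟩
  · rintro ⟨x, hx⟩
    exact ⟨coord a a x, by rw [← coord_map h0, hx, coord_incl_same]⟩

/-- A Hausdorff semitopological inverse monoid with zero and continuous inversion is
`H`-closed in the class of semitopological inverse semigroups with continuous
inversion iff for some (equivalently, for every) cardinal `λ ≥ 2` every topological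
Brandt `λ⁰`-extension of `S` in this class is `H`-closed in this class. -/
theorem stmt17 {S : Type u} [MonoidWithZero S] [TopologicalSpace S]
    (iS : S → S) (hS : IsSTISWCI iS) :
    (HClosedSTIS S ↔
        ∃ lam : Type u, 2 ≤ Cardinal.mk lam ∧
          ∀ (tB : TopologicalSpace (BrandtCarrier lam S))
            (iB : BrandtCarrier lam S → BrandtCarrier lam S),
            IsTopBrandtExt tB iB → @HClosedSTIS (BrandtCarrier lam S) _ tB) ∧
      (HClosedSTIS S ↔
        ∀ lam : Type u, 2 ≤ Cardinal.mk lam →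
          ∀ (tB : TopologicalSpace (BrandtCarrier lam S))
            (iB : BrandtCarrier lam S → BrandtCarrier lam S),
            IsTopBrandtExt tB iB → @HClosedSTIS (BrandtCarrier lam S) _ tB) := by
  have forward : HClosedSTIS S → ∀ lam : Type u, 2 ≤ Cardinal.mk lam →
      ∀ (tB : TopologicalSpace (BrandtCarrier lam S))
        (iB : BrandtCarrier lam S → BrandtCarrier lam S),
        IsTopBrandtExt tB iB → @HClosedSTIS (BrandtCarrier lam S) _ tB :=
    fun h _ _ tB _ hB => h.of_isTopBrandtExt tB hB
  have backward : (∃ lam : Type u, 2 ≤ Cardinal.mk lam ∧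
      ∀ (tB : TopologicalSpace (BrandtCarrier lam S))
        (iB : BrandtCarrier lam S → BrandtCarrier lam S),
        IsTopBrandtExt tB iB → @HClosedSTIS (BrandtCarrier lam S) _ tB) → HClosedSTIS S := by
    rintro ⟨lam, hlam, H⟩
    have : Nonempty lam := Cardinal.mk_ne_zero_iff.1 fun h0 => by simp [h0] at hlam
    exact hClosedSTIS_of_forall_isTopBrandtExt hS.2.1 H
  have two_le : 2 ≤ Cardinal.mk (ULift.{u} Bool) := by simp
  exact ⟨⟨fun h => ⟨_, two_le, forward h _ two_le⟩, backward⟩,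
    forward, fun h => backward ⟨_, two_le, h _ two_le⟩⟩
end

section
/- Let S be a semitopological inverse semigroup with continuous inversion such that S = ⋃_{α∈A} S_α, where (i) each S_α, with the subspace topology and induced operation, is an inverse subsemigroup of S which is H-closed in the class of semitopological inverse semigroups with continuous inversion, and (ii) there exists a two-sided ideal T of S which is an inverse subsemigroup H-closed in the class of semitopological inverse semigroups with continuous inversion and which satisfies S_α · S_β ⊆ T for all α ≠ β in A. Then S is H-closed in the class of semitopological inverse semigroups with continuous inversion. -/
open Topology

universe u v

/-- A subset `A` of `S`, with the subspace topology and the induced operation, is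
absolutely `H`-closed in the class of semitopological inverse semigroups with
continuous inversion. -/
def AbsHClosedSubsetSTIS {S : Type u} [Mul S] [TopologicalSpace S] (A : Set S) :
    Prop :=
  ∀ (T : Type u) [Mul T] [TopologicalSpace T] (iT : T → T), IsSTISWCI iT →
    ∀ h : A → T, Continuous h →
      (∀ (x y : A) (hxy : (x : S) * (y : S) ∈ A),
        h ⟨(x : S) * (y : S), hxy⟩ = h x * h y) →
      IsClosed (Set.range h)

/-- A subset `A` of `S`, with the subspace topology and the induced operation, is
`H`-closed in the class of semitopological inverse semigroups with continuous
inversion. -/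
def HClosedSubsetSTIS {S : Type u} [Mul S] [TopologicalSpace S] (A : Set S) : Prop :=
  ∀ (T : Type u) [Mul T] [TopologicalSpace T] (iT : T → T), IsSTISWCI iT →
    ∀ h : A → T,
      (∀ (x y : A) (hxy : (x : S) * (y : S) ∈ A),
        h ⟨(x : S) * (y : S), hxy⟩ = h x * h y) →
      IsEmbedding h → IsClosed (Set.range h)

/-- The image of an `H`-closed subset under an embedding is closed. -/
theorem HClosedSubsetSTIS.isClosed_image {S : Type u} [Mul S] [TopologicalSpace S] {A : Set S}
    (hA : HClosedSubsetSTIS A) {T : Type u} [Mul T] [TopologicalSpace T] {iT : T → T}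
    (hT : IsSTISWCI iT) {h : S → T} (hmul : ∀ x y : S, h (x * y) = h x * h y)
    (hemb : IsEmbedding h) : IsClosed (h '' A) := by
  have hcl := hA T iT hT (fun x : A => h x) (fun x y _ => hmul x y)
    (hemb.comp IsEmbedding.subtypeVal)
  rwa [Set.image_eq_range]

/-- Homomorphisms between inverse semigroups preserve inverses. -/
theorem IsInvOf.map_inv {S T : Type*} [Mul S] [Mul T] {i : S → S} {iT : T → T}
    (hi : IsInvOf i) (hiT : IsInvOf iT) {h : S → T}
    (hmul : ∀ x y : S, h (x * y) = h x * h y) (x : S) : h (i x) = iT (h x) := by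
  apply (hiT (h x)).2
  · rw [← hmul, ← hmul, (hi x).1.1]
  · rw [← hmul, ← hmul, (hi x).1.2]

/-- If a semitopological inverse semigroup with continuous inversion is a union of
`H`-closed inverse subsemigroups whose pairwise products lie in an `H`-closed
ideal, then it is `H`-closed in the class of semitopological inverse semigroups
with continuous inversion. -/
theorem stmt19 {S : Type u} [Mul S] [TopologicalSpace S]
    (i : S → S) (hS : IsSTISWCI i)
    {ι : Type v} (Sfam : ι → Set S) (hcover : (⋃ α, Sfam α) = Set.univ)
    (hsubmul : ∀ α, ∀ x ∈ Sfam α, ∀ y ∈ Sfam α, x * y ∈ Sfam α)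
    (hsubinv : ∀ α, ∀ x ∈ Sfam α, i x ∈ Sfam α)
    (hHcl : ∀ α, HClosedSubsetSTIS (Sfam α))
    (Tid : Set S)
    (hideal : ∀ x : S, ∀ t ∈ Tid, x * t ∈ Tid ∧ t * x ∈ Tid)
    (hTinv : ∀ t ∈ Tid, i t ∈ Tid)
    (hTH : HClosedSubsetSTIS Tid)
    (hprod : ∀ α β, α ≠ β → ∀ x ∈ Sfam α, ∀ y ∈ Sfam β, x * y ∈ Tid) :
    HClosedSTIS S := by
  intro T _ _ iT hT h hmul hemb
  have hTcl := hTH.isClosed_image hT hmul hemb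
  have hScl := fun α => (hHcl α).isClosed_image hT hmul hemb
  have hinv := hS.2.1.map_inv hT.2.1 hmul
  obtain ⟨⟨hassoc, -, hleft, hright⟩, hiT, hcont⟩ := hT
  refine isClosed_of_closure_subset fun y hy => ?_
  by_contra hyS
  have hmulT : ∀ x : S, h x * y ∈ h '' Tid := by
    intro x
    obtain ⟨α, hxα⟩ := Set.mem_iUnion.1 (hcover.symm ▸ Set.mem_univ x)
    have hyα : y ∈ (h '' Sfam α)ᶜ := fun hy' => hyS (Set.image_subset_range _ _ hy')
    have hy' : y ∈ closure ((h '' Sfam α)ᶜ ∩ Set.range h) :=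
      (hScl α).isOpen_compl.inter_closure ⟨hyα, hy⟩
    refine (hTcl.closure_subset_iff.2 subset_rfl) (map_mem_closure (hleft (h x)) hy' ?_)
    rintro _ ⟨hz, z, rfl⟩
    obtain ⟨β, hzβ⟩ := Set.mem_iUnion.1 (hcover.symm ▸ Set.mem_univ z)
    have hne : α ≠ β := by
      rintro rfl
      exact hz ⟨z, hzβ, rfl⟩
    exact ⟨x * z, hprod α β hne x hxα z hzβ, hmul x z⟩
  have hinvy : iT y ∈ closure (Set.range h) := by
    refine map_mem_closure hcont hy ?_
    rintro _ ⟨z, rfl⟩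
    exact ⟨i z, hinv z⟩
  have hidem : iT y * y ∈ h '' Tid := by
    refine (hTcl.closure_subset_iff.2 subset_rfl)
      (map_mem_closure (f := fun x => x * y) (hright y) hinvy ?_)
    rintro _ ⟨z, rfl⟩
    exact hmulT z
  have hprody : y * (iT y * y) ∈ h '' Tid := by
    refine (hTcl.closure_subset_iff.2 subset_rfl)
      (map_mem_closure (f := fun x => x * (iT y * y)) (hright _) hy ?_)
    rintro _ ⟨z, rfl⟩
    obtain ⟨t, ht, hte⟩ := hidem
    exact ⟨z * t, (hideal z t ht).1, by rw [hmul, hte]⟩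
  rw [← hassoc, (hiT y).1.1] at hprody
  exact hyS (Set.image_subset_range _ _ hprody)
end
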